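/- arXiv:1906.10350 — 3 statements merged into one kernel-verified Lean document; each statement's English description precedes it below -/
import Mathlib

section
/- Let S be a set of 2×2 complex matrices acting irreducibly on ℂ², and let h be a 2×2 complex matrix with det h = 1 such that conj(s) = h⁻¹·s·h for every s ∈ S. Then conj(h)·h = Id or conj(h)·h = −Id. -/
/-- Schur's lemma for a set of matrices over an algebraically closed field. -/
theorem Matrix.exists_eq_smul_one_of_irreducible {K n : Type*} [Field K] [IsAlgClosed K]
    [Fintype n] [DecidableEq n] [Nonempty n] {S : Set (Matrix n n K)}
    (hirr : ∀ W : Submodule K (n → K), (∀ s ∈ S, ∀ v ∈ W, s.mulVec v ∈ W) → W = ⊥ ∨ W = ⊤)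
    {A : Matrix n n K} (hA : ∀ s ∈ S, A * s = s * A) : ∃ c : K, A = c • 1 := by
  obtain ⟨c, hc⟩ := Module.End.exists_eigenvalue (Matrix.toLin' A)
  refine ⟨c, ?_⟩
  have hmem (v : n → K) : v ∈ Module.End.eigenspace (Matrix.toLin' A) c ↔ A.mulVec v = c • v := by
    rw [Module.End.mem_eigenspace_iff, Matrix.toLin'_apply]
  have htop : Module.End.eigenspace (Matrix.toLin' A) c = ⊤ := by
    refine (hirr _ fun s hs v hv => ?_).resolve_left hc
    rw [hmem] at hv ⊢
    rw [Matrix.mulVec_mulVec, hA s hs, ← Matrix.mulVec_mulVec, hv, Matrix.mulVec_smul]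
  apply Matrix.toLin'.injective
  ext1 v
  ext1
  simp only [LinearMap.comp_apply]
  have hv := (hmem (LinearMap.single K (fun _ => K) v 1)).1 (htop ▸ Submodule.mem_top)
  rw [Matrix.toLin'_apply, hv, Matrix.toLin'_apply, Matrix.smul_mulVec, Matrix.one_mulVec]


/-- If a set `S` of 2×2 complex matrices acts irreducibly on `ℂ²`, `h` has determinant `1`,
and `conj(s) = h⁻¹ · s · h` for every `s ∈ S`, then `conj(h)·h = ±Id`. Here `conj` is the
entrywise complex conjugate. -/
theorem conj_mul_self_pm_id (S : Set (Matrix (Fin 2) (Fin 2) ℂ))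
    (h : Matrix (Fin 2) (Fin 2) ℂ) (hdet : h.det = 1)
    (hirr : ∀ W : Submodule ℂ (Fin 2 → ℂ),
      (∀ s ∈ S, ∀ v ∈ W, s.mulVec v ∈ W) → W = ⊥ ∨ W = ⊤)
    (hconj : ∀ s ∈ S, s.map (starRingEnd ℂ) = h⁻¹ * s * h) :
    h.map (starRingEnd ℂ) * h = 1 ∨ h.map (starRingEnd ℂ) * h = -1 := by
  have hunit : IsUnit h.det := by simp [hdet]
  have hintertwine : ∀ s ∈ S, h * s.map (starRingEnd ℂ) = s * h := fun s hs => by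
    rw [hconj s hs, Matrix.mul_assoc h⁻¹, Matrix.mul_nonsing_inv_cancel_left _ _ hunit]
  have hintertwine_conj : ∀ s ∈ S,
      h.map (starRingEnd ℂ) * s = s.map (starRingEnd ℂ) * h.map (starRingEnd ℂ) := fun s hs => by
    have key := congrArg (fun M => M.map (starRingEnd ℂ)) (hintertwine s hs)
    simpa [Matrix.map_mul, Matrix.map_map, Function.comp_def] using key
  obtain ⟨c, hc⟩ := Matrix.exists_eq_smul_one_of_irreducible hirr
    (A := h * h.map (starRingEnd ℂ)) fun s hs => by
      rw [Matrix.mul_assoc, hintertwine_conj s hs, ← Matrix.mul_assoc, hintertwine s hs,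
        Matrix.mul_assoc]
  have hcomm : h.map (starRingEnd ℂ) * h = c • 1 := by
    rw [← Matrix.nonsing_inv_mul_cancel_left h (h.map (starRingEnd ℂ)) hunit, hc]
    simp [Matrix.nonsing_inv_mul h hunit]
  have hdet_conj : (h.map (starRingEnd ℂ)).det = 1 := by
    rw [← RingHom.mapMatrix_apply, ← RingHom.map_det, hdet, map_one]
  have hsq : c ^ 2 = 1 := by
    have := congrArg Matrix.det hcomm
    simpa [Matrix.det_mul, Matrix.det_smul, hdet, hdet_conj, eq_comm] using this
  rcases eq_or_eq_neg_of_sq_eq_sq c 1 (by simpa using hsq) with rfl | rfl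
  · left; simpa using hcomm
  · right; simpa using hcomm
end

section
/- Let h be a 2×2 complex matrix with conj(h)·h = Id. For each nonzero λ ∈ ℂ set g(λ) = diag(1, λ) and define g̃(λ) = g(λ)⁻¹ · h · conj(g(−1/conj(λ))). Then for every nonzero λ ∈ ℂ one has conj(g̃(−1/conj(λ))) · g̃(λ) = Id. -/
/-- The family of gauge transformations `g(λ) = diag(1, λ)`. -/
noncomputable def gdiag (l : ℂ) : Matrix (Fin 2) (Fin 2) ℂ := !![1, 0; 0, l]

/-- The reality gauge of a grafting section: `g̃(λ) = g(λ)⁻¹ · h · conj(g(-1/conj(λ)))`. -/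
noncomputable def gtil (h : Matrix (Fin 2) (Fin 2) ℂ) (l : ℂ) : Matrix (Fin 2) (Fin 2) ℂ :=
  (gdiag l)⁻¹ * h * (gdiag (-1 / (starRingEnd ℂ l))).map (starRingEnd ℂ)

lemma isUnit_det_gdiag {l : ℂ} (hl : l ≠ 0) : IsUnit (gdiag l).det := by
  simpa [gdiag, Matrix.det_fin_two_of] using hl

lemma map_conj_gdiag_inv_mul {l : ℂ} (hl : l ≠ 0) :
    ((gdiag l)⁻¹).map (starRingEnd ℂ) * (gdiag l).map (starRingEnd ℂ) = 1 := by
  rw [← Matrix.map_mul, Matrix.nonsing_inv_mul _ (isUnit_det_gdiag hl),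
    Matrix.map_one _ (map_zero _) (map_one _)]

lemma map_conj_map_conj (M : Matrix (Fin 2) (Fin 2) ℂ) :
    (M.map (starRingEnd ℂ)).map (starRingEnd ℂ) = M := by
  ext i j
  simp

lemma antipodal_antipodal (l : ℂ) :
    -1 / (starRingEnd ℂ) (-1 / (starRingEnd ℂ) l) = l := by
  simp [neg_div]

/-- If `conj(h)·h = Id` then the reality gauge `g̃` satisfies
`conj(g̃(-1/conj(λ))) · g̃(λ) = Id` for all nonzero `λ`. -/
theorem gtil_reality (h : Matrix (Fin 2) (Fin 2) ℂ)
    (hh : h.map (starRingEnd ℂ) * h = 1) :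
    ∀ l : ℂ, l ≠ 0 →
      (gtil h (-1 / (starRingEnd ℂ l))).map (starRingEnd ℂ) * gtil h l = 1 := by
  intro l hl
  have hm : -1 / (starRingEnd ℂ) l ≠ 0 := by simpa using hl
  simp only [gtil, antipodal_antipodal, Matrix.map_mul, map_conj_map_conj]
  set m := -1 / (starRingEnd ℂ) l
  calc ((gdiag m)⁻¹).map (starRingEnd ℂ) * h.map (starRingEnd ℂ) * gdiag l *
        ((gdiag l)⁻¹ * h * (gdiag m).map (starRingEnd ℂ))
      = ((gdiag m)⁻¹).map (starRingEnd ℂ) * (h.map (starRingEnd ℂ) *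
        (gdiag l * (gdiag l)⁻¹) * h) * (gdiag m).map (starRingEnd ℂ) := by
        simp only [Matrix.mul_assoc]
    _ = 1 := by
        rw [Matrix.mul_nonsing_inv _ (isUnit_det_gdiag hl), Matrix.mul_one, hh,
          Matrix.mul_one, map_conj_gdiag_inv_mul hm]
end

section
/- Let h be a 2×2 complex matrix with conj(h)·h = Id. For each nonzero λ ∈ ℂ set g(λ) = diag(1, λ) and define ĝ(λ) = λ · g(λ)⁻¹ · h · conj(g(−1/conj(λ))). Then for every nonzero λ ∈ ℂ one has conj(ĝ(−1/conj(λ))) · ĝ(λ) = −Id; moreover, if det h = −1 then det ĝ(λ) = 1 for every nonzero λ. -/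
/-- The normalized reality gauge `ĝ(λ) = λ · g(λ)⁻¹ · h · conj(g(-1/conj(λ)))`. -/
noncomputable def ghat (h : Matrix (Fin 2) (Fin 2) ℂ) (l : ℂ) : Matrix (Fin 2) (Fin 2) ℂ :=
  l • ((gdiag l)⁻¹ * h * (gdiag (-1 / (starRingEnd ℂ l))).map (starRingEnd ℂ))

/-- The inverse of `diag(1, λ)` is `diag(1, λ⁻¹)`. -/
theorem gdiag_inv {l : ℂ} (hl : l ≠ 0) : (gdiag l)⁻¹ = gdiag l⁻¹ := by
  apply Matrix.inv_eq_right_inv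
  simp [gdiag, Matrix.one_fin_two, hl]

/-- The entrywise conjugate of `diag(1, λ)` is `diag(1, conj λ)`. -/
theorem gdiag_map_conj (l : ℂ) : (gdiag l).map (starRingEnd ℂ) = gdiag (starRingEnd ℂ l) := by
  ext i j
  fin_cases i <;> fin_cases j <;> simp [gdiag]

/-- The entries of `ĝ(λ)` in terms of those of `h`. -/
theorem ghat_eq (h : Matrix (Fin 2) (Fin 2) ℂ) {l : ℂ} (hl : l ≠ 0) :
    ghat h l = !![l * h 0 0, -h 0 1; h 1 0, -h 1 1 / l] := by
  rw [ghat, gdiag_inv hl, gdiag_map_conj, Matrix.eta_fin_two h]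
  ext i j
  fin_cases i <;> fin_cases j <;> simp [gdiag] <;> field_simp

/-- If `conj(h)·h = Id`, then `conj(ĝ(-1/conj(λ))) · ĝ(λ) = -Id` for all nonzero `λ`;
moreover if `det h = -1` then `det ĝ(λ) = 1` for all nonzero `λ`. -/
theorem ghat_negative (h : Matrix (Fin 2) (Fin 2) ℂ)
    (hh : h.map (starRingEnd ℂ) * h = 1) :
    (∀ l : ℂ, l ≠ 0 →
      (ghat h (-1 / (starRingEnd ℂ l))).map (starRingEnd ℂ) * ghat h l = -1) ∧
    (h.det = -1 → ∀ l : ℂ, l ≠ 0 → (ghat h l).det = 1) := by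
  refine ⟨fun l hl => ?_, fun hdet l hl => ?_⟩
  · have entry (i j : Fin 2) := congrFun₂ hh i j
    simp only [Matrix.mul_apply, Fin.sum_univ_two, Matrix.map_apply] at entry
    have h00 := entry 0 0
    have h01 := entry 0 1
    have h10 := entry 1 0
    have h11 := entry 1 1
    simp only [Matrix.one_apply, Fin.isValue, if_true, zero_ne_one, one_ne_zero, if_false]
      at h00 h01 h10 h11
    have hl' : -1 / starRingEnd ℂ l ≠ 0 := by simpa using hl
    rw [ghat_eq h hl, ghat_eq h hl']
    ext i j
    fin_cases i <;> fin_cases j <;> simp [Matrix.mul_apply, Fin.sum_univ_two] <;> field_simp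
    · linear_combination -h00
    · linear_combination h01
    · linear_combination l * h10
    · linear_combination -h11
  · rw [Matrix.det_fin_two] at hdet
    rw [ghat_eq h hl, Matrix.det_fin_two_of]
    field_simp
    linear_combination -hdet
end
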